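/- Over a field k of characteristic zero, the maps g₁: (x₀:x₁:x₂:x₃) ↦ (-x₀-x₁-x₂-x₃ : x₀ : x₁ : x₂) and g₂: (x₀:x₁:x₂:x₃) ↦ (x₁:x₀:x₂:x₃) are automorphisms of ℙ³ preserving the Clebsch cubic surface, and the subgroup of PGL₄(k) they generate is isomorphic to the symmetric group S₅. -/

import Mathlib

/-- The Clebsch cubic form `Σ_{i≠j} xᵢ²xⱼ + 2 Σ_{i<j<l} xᵢxⱼx_l`. -/
def clebschForm {k : Type*} [Field k] (v : Fin 4 → k) : k :=
  (∑ i, ∑ j, if i ≠ j then v i ^ 2 * v j else 0) +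
    2 * ∑ i, ∑ j, ∑ l, if i < j ∧ j < l then v i * v j * v l else 0

theorem clebschForm_eq {k : Type*} [Field k] (v : Fin 4 → k) :
    3 * clebschForm v = (v 0 + v 1 + v 2 + v 3) ^ 3 - (v 0 ^ 3 + v 1 ^ 3 + v 2 ^ 3 + v 3 ^ 3) := by
  simp [clebschForm, Fin.sum_univ_four]
  ring

theorem clebschForm_zero_iff {k : Type*} [Field k] [CharZero k] (v : Fin 4 → k) :
    clebschForm v = 0 ↔
      (v 0 + v 1 + v 2 + v 3) ^ 3 - (v 0 ^ 3 + v 1 ^ 3 + v 2 ^ 3 + v 3 ^ 3) = 0 := by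
  rw [← clebschForm_eq]
  simp

/-- Rows of the standard representation. -/
def clRow (k : Type*) [Field k] (a : Fin 5) : Fin 4 → k :=
  fun j => if a = j.castSucc then 1 else if a = Fin.last 4 then -1 else 0

/-- Standard representation matrix. -/
def clMat (k : Type*) [Field k] (s : Equiv.Perm (Fin 5)) : Matrix (Fin 4) (Fin 4) k :=
  fun i => clRow k (s⁻¹ i.castSucc)

theorem clRow_cast (k : Type*) [Field k] (i : Fin 4) : clRow k i.castSucc = Pi.single i 1 := by
  ext j
  simp only [clRow, Fin.castSucc_ne_last, if_false, Fin.castSucc_inj, Pi.single_apply, eq_comm]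

theorem clRow_last (k : Type*) [Field k] : clRow k (Fin.last 4) = fun _ => -1 := by
  ext j
  simp only [clRow, (Fin.castSucc_ne_last j).symm, if_false, if_true]

theorem clRow_sum (k : Type*) [Field k] : ∑ a, clRow k a = 0 := by
  rw [Fin.sum_univ_castSucc]
  simp only [clRow_cast, clRow_last]
  ext j
  simp [Finset.sum_apply, Pi.single_apply]

theorem clRow_mul (k : Type*) [Field k] (t : Equiv.Perm (Fin 5)) (a : Fin 5) :
    Matrix.vecMul (clRow k a) (clMat k t) = clRow k (t⁻¹ a) := by
  have hs : ∑ a, clRow k (t⁻¹ a) = 0 := by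
    rw [Equiv.sum_comp t⁻¹ (clRow k)]; exact clRow_sum k
  rw [Fin.sum_univ_castSucc] at hs
  induction a using Fin.lastCases with
  | last =>
    rw [← neg_eq_of_add_eq_zero_right hs, clRow_last]
    ext j
    simp only [Matrix.vecMul, dotProduct, clMat, Pi.neg_apply, Finset.sum_apply, neg_mul, one_mul,
      Finset.sum_neg_distrib]
  | cast i =>
    rw [clRow_cast, Matrix.single_one_vecMul]
    rfl

theorem clMat_mul (k : Type*) [Field k] (s t : Equiv.Perm (Fin 5)) :
    clMat k (s * t) = clMat k s * clMat k t := by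
  ext i j
  have := congrFun (clRow_mul k t (s⁻¹ i.castSucc)) j
  simp only [clMat, mul_inv_rev, Equiv.Perm.mul_apply, ← this]
  rfl

theorem clMat_one (k : Type*) [Field k] : clMat k 1 = 1 := by
  ext i j
  simp only [clMat, inv_one, Equiv.Perm.one_apply, clRow_cast, Matrix.one_apply, Pi.single_apply,
    eq_comm]

/-- Standard representation. -/
def clHom (k : Type*) [Field k] : Equiv.Perm (Fin 5) →* GL (Fin 4) k :=
  MonoidHom.toHomUnits ⟨⟨clMat k, clMat_one k⟩, clMat_mul k⟩

theorem clHom_coe (k : Type*) [Field k] (s : Equiv.Perm (Fin 5)) :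
    (clHom k s : Matrix (Fin 4) (Fin 4) k) = clMat k s := rfl

theorem clRow_inj (k : Type*) [Field k] [CharZero k] (a b : Fin 5)
    (h : clRow k a = clRow k b) : a = b := by
  have h1 : (1 : k) ≠ -1 := by
    intro h
    have : (2 : k) = 0 := by linear_combination h
    exact two_ne_zero this
  have h0 := congrFun h 0
  have h1 := congrFun h 1
  have h2 := congrFun h 2
  have h3 := congrFun h 3
  fin_cases a <;> fin_cases b <;> simp_all [clRow, Fin.ext_iff]

theorem clHom_inj (k : Type*) [Field k] [CharZero k] :
    Function.Injective (clHom k) := by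
  intro s t h
  have hm : clMat k s = clMat k t := by rw [← clHom_coe, ← clHom_coe, h]
  have hc : ∀ i : Fin 4, s⁻¹ i.castSucc = t⁻¹ i.castSucc := fun i =>
    clRow_inj k _ _ (congrFun hm i)
  apply inv_injective
  have hlast : s⁻¹ (Fin.last 4) = t⁻¹ (Fin.last 4) := by
    obtain ⟨x, hx⟩ := (s⁻¹).surjective (t⁻¹ (Fin.last 4))
    induction x using Fin.lastCases with
    | last => exact hx
    | cast i =>
      rw [hc] at hx
      exact absurd ((t⁻¹).injective hx) (Fin.castSucc_ne_last i)
  ext a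
  induction a using Fin.lastCases with
  | last => rw [hlast]
  | cast i => rw [hc]

theorem perm5_center : ∀ s : Equiv.Perm (Fin 5),
    (∀ t, s * t = t * s) → s = 1 := by
  intro s h
  ext a
  by_contra hne0
  have hne : s a ≠ a := fun h => hne0 (by rw [h]; rfl)
  obtain ⟨c, hca, hcs⟩ : ∃ c, c ≠ a ∧ c ≠ s a := by
    clear hne0; revert hne; generalize s a = b; clear h; revert a b; decide
  have := congrArg (fun f => f a) (h (Equiv.swap (s a) c))
  simp only [Equiv.Perm.mul_apply, Equiv.swap_apply_left,
    Equiv.swap_apply_of_ne_of_ne hne.symm hca.symm] at this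
  exact hcs this.symm

/-- The maps `g₁ : (x₀:x₁:x₂:x₃) ↦ (-x₀-x₁-x₂-x₃ : x₀ : x₁ : x₂)` and
`g₂ : (x₀:x₁:x₂:x₃) ↦ (x₁:x₀:x₂:x₃)` are automorphisms of `ℙ³` preserving the Clebsch
cubic surface, and the subgroup of `PGL₄(k)` they generate is isomorphic to `S₅`. -/
theorem stmt10 (k : Type*) [Field k] [CharZero k]
    (A B : GL (Fin 4) k)
    (hA : (A : Matrix (Fin 4) (Fin 4) k) =
      !![-1, -1, -1, -1; 1, 0, 0, 0; 0, 1, 0, 0; 0, 0, 1, 0])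
    (hB : (B : Matrix (Fin 4) (Fin 4) k) =
      !![0, 1, 0, 0; 1, 0, 0, 0; 0, 0, 1, 0; 0, 0, 0, 1]) :
    (∀ v : Fin 4 → k, clebschForm v = 0 →
      clebschForm ((A : Matrix (Fin 4) (Fin 4) k).mulVec v) = 0) ∧
    (∀ v : Fin 4 → k, clebschForm v = 0 →
      clebschForm ((B : Matrix (Fin 4) (Fin 4) k).mulVec v) = 0) ∧
    Nonempty
      ((Subgroup.closure
          ({QuotientGroup.mk' (Subgroup.center (GL (Fin 4) k)) A,
            QuotientGroup.mk' (Subgroup.center (GL (Fin 4) k)) B} :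
            Set (GL (Fin 4) k ⧸ Subgroup.center (GL (Fin 4) k)))) ≃*
        Equiv.Perm (Fin 5)) := by
  have eA : A = clHom k (finRotate 5) := by
    apply Units.ext
    rw [hA, clHom_coe]
    ext i j
    have h0 : (finRotate 5)⁻¹ 0 = 4 := by decide
    have h1 : (finRotate 5)⁻¹ 1 = 0 := by decide
    have h2 : (finRotate 5)⁻¹ 2 = 1 := by decide
    have h3 : (finRotate 5)⁻¹ 3 = 2 := by decide
    fin_cases i <;> fin_cases j <;> simp [clMat, clRow, h0, h1, h2, h3, Fin.ext_iff]
  have eB : B = clHom k (Equiv.swap 0 1) := by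
    apply Units.ext
    rw [hB, clHom_coe]
    ext i j
    have h0 : (Equiv.swap (0 : Fin 5) 1) 0 = 1 := by decide
    have h1 : (Equiv.swap (0 : Fin 5) 1) 1 = 0 := by decide
    have h2 : (Equiv.swap (0 : Fin 5) 1) 2 = 2 := by decide
    have h3 : (Equiv.swap (0 : Fin 5) 1) 3 = 3 := by decide
    fin_cases i <;> fin_cases j <;> simp [clMat, clRow, h0, h1, h2, h3, Fin.ext_iff]
  refine ⟨?_, ?_, ?_⟩
  · intro v hv
    rw [hA]
    rw [clebschForm_zero_iff] at hv ⊢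
    simp [Fin.sum_univ_four, Matrix.mulVec, dotProduct]
    linear_combination hv
  · intro v hv
    rw [hB]
    rw [clebschForm_zero_iff] at hv ⊢
    simp [Fin.sum_univ_four, Matrix.mulVec, dotProduct]
    linear_combination hv
  · set q := QuotientGroup.mk' (Subgroup.center (GL (Fin 4) k)) with hq
    have hinj : Function.Injective (q.comp (clHom k)) := by
      rw [injective_iff_map_eq_one]
      intro s hs
      have hs' : clHom k s ∈ Subgroup.center (GL (Fin 4) k) :=
        (QuotientGroup.eq_one_iff _).1 hs
      apply perm5_center
      intro t
      apply clHom_inj k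
      rw [map_mul, map_mul]
      exact (Subgroup.mem_center_iff.1 hs' _).symm
    have hcl : Subgroup.closure ({finRotate 5, Equiv.swap 0 1} : Set (Equiv.Perm (Fin 5))) = ⊤ := by
      have := Equiv.Perm.closure_cycle_adjacent_swap (σ := finRotate 5)
        isCycle_finRotate support_finRotate 0
      exact this
    have hr : Subgroup.closure {q A, q B} = (q.comp (clHom k)).range := by
      rw [MonoidHom.range_eq_map, ← hcl, MonoidHom.map_closure, Set.image_pair, eA, eB]
      rfl
    rw [hr]
    exact ⟨(MonoidHom.ofInjective hinj).symm⟩
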